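/- (Nehari-type matching of semi-eigenvalues.) Assume F satisfies (F1), (F2) and (F3). For every integer n ≥ 1 there exist points a < t₁ < t₂ < ... < tₙ < b such that, setting t₀ = a and t_{n+1} = b and writing λ^{(+1)} = λ⁺, λ^{(−1)} = λ⁻, one has λ^{(−1)^i}(t_{i−1}, t_i) = λ^{(−1)^{i+1}}(t_i, t_{i+1}) for every i = 1, ..., n. -/

import Mathlib

open Set

/-- `u ∈ C²(c,d) ∩ C¹([c,d])`, with first derivative `u'` (one-sided at the endpoints)
and second derivative `u''` on the open interval. -/
def C2Fun (c d : ℝ) (u u' u'' : ℝ → ℝ) : Prop :=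
  (∀ t ∈ Set.Icc c d, HasDerivWithinAt u (u' t) (Set.Icc c d) t) ∧
  ContinuousOn u' (Set.Icc c d) ∧
  (∀ t ∈ Set.Ioo c d, HasDerivAt u' (u'' t) t) ∧
  ContinuousOn u'' (Set.Ioo c d)

/-- `μ = λ⁺(c,d)`: the problem `F(u'',u',u,t) = -μ u` on `(c,d)`, `u(c)=u(d)=0`,
has a solution which is positive on `(c,d)`. -/
def IsPosEigenvalue (F : ℝ → ℝ → ℝ → ℝ → ℝ) (c d μ : ℝ) : Prop :=
  ∃ u u' u'' : ℝ → ℝ, C2Fun c d u u' u'' ∧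
    (∀ t ∈ Set.Ioo c d, F (u'' t) (u' t) (u t) t = -μ * u t) ∧
    u c = 0 ∧ u d = 0 ∧ (∀ t ∈ Set.Ioo c d, 0 < u t)

/-- `μ = λ⁻(c,d)`: same with a negative solution. -/
def IsNegEigenvalue (F : ℝ → ℝ → ℝ → ℝ → ℝ) (c d μ : ℝ) : Prop :=
  ∃ u u' u'' : ℝ → ℝ, C2Fun c d u u' u'' ∧
    (∀ t ∈ Set.Ioo c d, F (u'' t) (u' t) (u t) t = -μ * u t) ∧
    u c = 0 ∧ u d = 0 ∧ (∀ t ∈ Set.Ioo c d, u t < 0)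

/-- An operator that is uniformly elliptic in its first argument can be solved for it; the solution
is jointly continuous and Lipschitz in the remaining scalar arguments. -/
theorem exists_elliptic_inverse {lam Lam gam del : ℝ} (hlam : 0 < lam)
    {F : ℝ → ℝ → ℝ → ℝ → ℝ}
    (hF : Continuous fun z : ℝ × ℝ × ℝ × ℝ => F z.1 z.2.1 z.2.2.1 z.2.2.2)
    (hF2 : ∀ m p u m' p' u' t : ℝ,
      lam * max (m - m') 0 - Lam * max (-(m - m')) 0 - gam * |p - p'| - del * |u - u'|
          ≤ F m p u t - F m' p' u' t ∧
        F m p u t - F m' p' u' t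
          ≤ Lam * max (m - m') 0 - lam * max (-(m - m')) 0 + gam * |p - p'| + del * |u - u'|) :
    ∃ H : ℝ → ℝ → ℝ → ℝ → ℝ, (∀ p u w t, F (H p u w t) p u t = w) ∧
      (Continuous fun z : ℝ × ℝ × ℝ × ℝ => H z.1 z.2.1 z.2.2.1 z.2.2.2) ∧
      ∀ p u w p' u' w' t, lam * |H p u w t - H p' u' w' t|
        ≤ |w - w'| + gam * |p - p'| + del * |u - u'| := by
  have expand : ∀ m p u m' p' u' t : ℝ, lam * |m - m'|
      ≤ |F m p u t - F m' p' u' t| + gam * |p - p'| + del * |u - u'| := by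
    intro m p u m' p' u' t
    obtain ⟨h1, h2⟩ := hF2 m p u m' p' u' t
    rcases le_total 0 (m - m') with h | h
    · rw [abs_of_nonneg h]
      rw [max_eq_left h, max_eq_right (by linarith)] at h1
      linarith [le_abs_self (F m p u t - F m' p' u' t)]
    · rw [abs_of_nonpos h]
      rw [max_eq_right h, max_eq_left (by linarith)] at h2
      linarith [neg_abs_le (F m p u t - F m' p' u' t)]
  have surj : ∀ p u w t, ∃ m, F m p u t = w := by
    intro p u w t
    have hc : Continuous fun m => F m p u t :=
      hF.comp (by fun_prop : Continuous fun m : ℝ => (m, p, u, t))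
    refine hc.surjective ?_ ?_ w
    · refine Filter.tendsto_atTop_mono' _ ?_ (Filter.tendsto_atTop_add_const_right _ (F 0 p u t)
        (Filter.tendsto_id.const_mul_atTop hlam))
      filter_upwards [Filter.eventually_ge_atTop 0] with m hm
      have := (hF2 m p u 0 p u t).1
      simp [hm] at this
      simp only [id]; linarith
    · refine Filter.tendsto_atBot_mono' _ ?_ (Filter.tendsto_atBot_add_const_right _ (F 0 p u t)
        (Filter.tendsto_id.const_mul_atBot hlam))
      filter_upwards [Filter.eventually_le_atBot 0] with m hm
      have := (hF2 m p u 0 p u t).2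
      simp [hm] at this
      simp only [id]; linarith
  choose H hH using surj
  refine ⟨H, hH, ?_, fun p u w p' u' w' t => ?_⟩
  · rw [continuous_iff_continuousAt]
    rintro ⟨p₀, u₀, w₀, t₀⟩
    rw [ContinuousAt, tendsto_iff_dist_tendsto_zero]
    have hlim : Filter.Tendsto (fun z : ℝ × ℝ × ℝ × ℝ =>
        |z.2.2.1 - F (H p₀ u₀ w₀ t₀) z.1 z.2.1 z.2.2.2| / lam) (nhds (p₀, u₀, w₀, t₀)) (nhds 0) := by
      have hc : Continuous fun z : ℝ × ℝ × ℝ × ℝ =>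
          |z.2.2.1 - F (H p₀ u₀ w₀ t₀) z.1 z.2.1 z.2.2.2| / lam := by
        have := hF.comp (by fun_prop : Continuous fun z : ℝ × ℝ × ℝ × ℝ =>
          (H p₀ u₀ w₀ t₀, z.1, z.2.1, z.2.2.2))
        simp only [Function.comp_def] at this
        fun_prop
      have := hc.tendsto (p₀, u₀, w₀, t₀)
      simpa [hH] using this
    refine squeeze_zero (fun _ => dist_nonneg) (fun z => ?_) hlim
    have := expand (H z.1 z.2.1 z.2.2.1 z.2.2.2) z.1 z.2.1 (H p₀ u₀ w₀ t₀) z.1 z.2.1 z.2.2.2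
    rw [hH] at this
    simp only [sub_self, abs_zero, mul_zero, add_zero] at this
    rw [Real.dist_eq, le_div_iff₀ hlam]
    linarith
  · have hle := expand (H p u w t) p u (H p' u' w' t) p' u' t
    simpa [hH] using hle

/-- A scalar ODE with bounded, Lipschitz right-hand side depending Lipschitz-continuously on a
parameter has global solutions whose final value is continuous in the parameter. -/
theorem exists_solution_family {a b : ℝ} (hab : a ≤ b) (x₀ : ℝ) {v : ℝ → ℝ → ℝ → ℝ}
    {M K : ℝ → ℝ} {C : ℝ} (hcont : ∀ μ x, Continuous fun t => v μ t x)
    (hbound : ∀ μ t x, |v μ t x| ≤ M μ)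
    (hlip : ∀ μ t x y, |v μ t x - v μ t y| ≤ K μ * |x - y|)
    (hpar : ∀ μ ν t x, |v μ t x - v ν t x| ≤ C * |μ - ν|) :
    ∃ ψ : ℝ → ℝ → ℝ, (∀ μ, ψ μ a = x₀) ∧
      (∀ μ, ∀ t ∈ Icc a b, HasDerivWithinAt (ψ μ) (v μ t (ψ μ t)) (Icc a b) t) ∧
      Continuous fun μ => ψ μ b := by
  have hlip' : ∀ μ t, LipschitzWith (K μ).toNNReal (v μ t) := fun μ t =>
    LipschitzWith.of_dist_le_mul fun x y => by
      rw [Real.dist_eq, Real.dist_eq]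
      exact (hlip μ t x y).trans
        (mul_le_mul_of_nonneg_right (Real.le_coe_toNNReal _) (abs_nonneg _))
  have hex : ∀ μ, ∃ ψ : ℝ → ℝ, ψ a = x₀ ∧
      ∀ t ∈ Icc a b, HasDerivWithinAt ψ (v μ t (ψ t)) (Icc a b) t := by
    intro μ
    have hPL : IsPicardLindelof (v μ) (⟨a, left_mem_Icc.2 hab⟩ : Icc a b) x₀
        ((M μ).toNNReal * (b - a).toNNReal) 0 (M μ).toNNReal (K μ).toNNReal :=
      { lipschitzOnWith := fun t _ => (hlip' μ t).lipschitzOnWith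
        continuousOn := fun x _ => (hcont μ x).continuousOn
        norm_le := fun t _ x _ => (hbound μ t x).trans (Real.le_coe_toNNReal _)
        mul_max_le := by simp [hab] }
    exact hPL.exists_eq_forall_mem_Icc_hasDerivWithinAt₀
  choose ψ hψ₀ hψ using hex
  refine ⟨ψ, hψ₀, hψ, continuous_iff_continuousAt.2 fun μ => ?_⟩
  have hright : ∀ ν, ∀ t ∈ Ico a b, HasDerivWithinAt (ψ ν) (v ν t (ψ ν t)) (Ici t) t :=
    fun ν t ht => (hψ ν t ⟨ht.1, ht.2.le⟩).mono_of_mem_nhdsWithin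
      (Filter.mem_of_superset (Icc_mem_nhdsGE ht.2) (Icc_subset_Icc_left ht.1))
  rw [ContinuousAt, tendsto_iff_dist_tendsto_zero]
  have hlim : Filter.Tendsto (fun ν => gronwallBound 0 (K μ).toNNReal (C * |ν - μ| + 0) (b - a))
      (nhds μ) (nhds 0) := by
    have hc : Continuous fun ν => gronwallBound 0 (K μ).toNNReal (C * |ν - μ| + 0) (b - a) :=
      (gronwallBound_continuous_ε 0 _ (b - a)).comp (by fun_prop)
    simpa [gronwallBound_ε0_δ0] using hc.tendsto μ
  refine squeeze_zero (fun _ => dist_nonneg) (fun ν => ?_) hlim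
  refine dist_le_of_approx_trajectories_ODE (v := v μ) (hlip' μ)
    (fun t ht => (hψ ν t ht).continuousWithinAt) (hright ν) (fun t _ => hpar ν μ t _)
    (fun t ht => (hψ μ t ht).continuousWithinAt) (hright μ) (fun t _ => by simp) ?_ b
    (right_mem_Icc.2 hab)
  simp [hψ₀]

/-- A function whose derivative is positive wherever it takes the value `c` crosses that level
upwards only. -/
theorem lt_of_deriv_pos_at_level {a b c : ℝ} {ψ ψ' : ℝ → ℝ}
    (hψ : ∀ t ∈ Icc a b, HasDerivWithinAt ψ (ψ' t) (Icc a b) t)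
    (hpos : ∀ t ∈ Icc a b, ψ t = c → 0 < ψ' t) {s t : ℝ} (hs : s ∈ Icc a b) (ht : t ∈ Icc a b)
    (hst : s < t) (hc : c ≤ ψ s) : c < ψ t := by
  have hsub : Icc s t ⊆ Icc a b := Icc_subset_Icc hs.1 ht.2
  have key : ∀ x ∈ Icc s t, c ≤ ψ x := fun x hx =>
    image_le_of_deriv_right_lt_deriv_boundary' (f := fun _ => c) (f' := fun _ => 0) (B := ψ)
      (B' := ψ') continuousOn_const (fun x _ => hasDerivWithinAt_const x _ c) hc
      (fun x hx => ((hψ x (hsub hx)).mono hsub).continuousWithinAt)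
      (fun x hx => (hψ x (hsub (Ico_subset_Icc_self hx))).mono_of_mem_nhdsWithin
        (Filter.mem_of_superset (Icc_mem_nhdsGE hx.2)
          (Icc_subset_Icc (hs.1.trans hx.1) ht.2)))
      (fun x hx h => hpos x (hsub (Ico_subset_Icc_self hx)) h.symm) hx
  refine lt_of_le_of_ne (key t (right_mem_Icc.2 hst.le)) fun h => ?_
  have hd : HasDerivWithinAt ψ (ψ' t) (Iio t) t :=
    (hψ t ht).mono_of_mem_nhdsWithin
      (Filter.mem_of_superset (Ioo_mem_nhdsLT hst)
        (fun x hx => ⟨hs.1.trans hx.1.le, hx.2.le.trans ht.2⟩))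
  have hlim := hasDerivWithinAt_iff_tendsto_slope' (by simp) |>.1 hd
  have hev := hlim.eventually (lt_mem_nhds (hpos t ht h.symm))
  obtain ⟨x, hx, hxs⟩ := (hev.and (Ioo_mem_nhdsLT hst)).exists
  rw [slope_def_field, ← h] at hx
  have := key x ⟨hxs.1.le, hxs.2.le⟩
  exact absurd hx (not_lt.2 (div_nonpos_of_nonneg_of_nonpos (by linarith) (by linarith [hxs.2])))

/-- A lower bound, uniform in the angle, for the speed of the scaled Prüfer angle when
`μ = del + Lam * k ^ 2`. -/
theorem pruefer_speed_ge {lam Lam gam del k s c m : ℝ} (hlam : 0 < lam) (hLam : lam ≤ Lam)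
    (hgam : 0 < gam) (hk : 0 < k) (hsc : s ^ 2 + c ^ 2 = 1)
    (h1 : lam * max m 0 - Lam * max (-m) 0 - gam * (k * |c|) - del * |s|
      ≤ -(del + Lam * k ^ 2) * s)
    (h2 : -(del + Lam * k ^ 2) * s
      ≤ Lam * max m 0 - lam * max (-m) 0 + gam * (k * |c|) + del * |s|) :
    k - gam / lam ≤ k * c ^ 2 - s * m / k := by
  have hLam0 : 0 < Lam := hlam.trans_le hLam
  have main : ∀ s m : ℝ, 0 ≤ s →
      lam * max m 0 - Lam * max (-m) 0 ≤ -(Lam * k ^ 2) * s + gam * (k * |c|) →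
      lam * (s * m) ≤ -(lam * k ^ 2) * s ^ 2 + gam * k * (|c| * s) := by
    intro s m hs hm
    have hkc : 0 ≤ gam * (k * |c|) := by positivity
    have hm' : lam * m ≤ -(lam * k ^ 2) * s + gam * (k * |c|) := by
      rcases le_total 0 m with h0 | h0
      · rw [max_eq_left h0, max_eq_right (by linarith)] at hm
        linarith [mul_nonneg (sub_nonneg.2 hLam) (by positivity : 0 ≤ k ^ 2 * s)]
      · rw [max_eq_right h0, max_eq_left (by linarith)] at hm
        have h3 : Lam * (m + k ^ 2 * s) ≤ gam * (k * |c|) := by linarith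
        rcases le_total 0 (m + k ^ 2 * s) with h4 | h4
        · linarith [mul_le_mul_of_nonneg_right hLam h4]
        · linarith [mul_nonpos_of_nonneg_of_nonpos hlam.le h4]
    linarith [mul_le_mul_of_nonneg_left hm' hs]
  have hsm : lam * (s * m) ≤ -(lam * k ^ 2) * s ^ 2 + gam * k * (|c| * |s|) := by
    rcases le_total 0 s with hs | hs
    · rw [abs_of_nonneg hs] at h1 ⊢
      exact main s m hs (by linarith)
    · rw [abs_of_nonpos hs] at h2 ⊢
      have := main (-s) (-m) (by linarith) (by rw [neg_neg]; linarith)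
      linarith
  have hcs : |c| * |s| ≤ 1 := by
    linarith [sq_abs c, sq_abs s, sq_nonneg (|c| - |s|), mul_nonneg (abs_nonneg c) (abs_nonneg s)]
  have e2 : s * m / k ≤ -k * s ^ 2 + gam / lam := by
    rw [div_le_iff₀ hk]
    have h5 : lam * (s * m) ≤ lam * ((-k * s ^ 2 + gam / lam) * k) := by
      have : lam * ((-k * s ^ 2 + gam / lam) * k)
          = -(lam * k ^ 2) * s ^ 2 + gam * k := by field_simp
      rw [this]
      have := mul_le_of_le_one_right (by positivity : 0 ≤ gam * k) hcs
      linarith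
    exact le_of_mul_le_mul_left h5 hlam
  have : k * c ^ 2 = k - k * s ^ 2 := by linear_combination k * hsc
  linarith

/-- Shooting in the phase plane: for a suitable `μ`, the scaled Prüfer angle `ψ` of the equation
`F(u'', u', u, t) = -μ u` makes exactly `n + 1` half turns on `[a, b]`. -/
theorem exists_pruefer_angle {a b lam Lam gam del : ℝ} (hab : a < b) (hlam : 0 < lam)
    (hLam : lam ≤ Lam) (hgam : 0 < gam) (hdel : 0 < del) {F : ℝ → ℝ → ℝ → ℝ → ℝ}
    (hF : Continuous fun z : ℝ × ℝ × ℝ × ℝ => F z.1 z.2.1 z.2.2.1 z.2.2.2)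
    (hF0 : ∀ t, F 0 0 0 t = 0)
    (hF2 : ∀ m p u m' p' u' t : ℝ,
      lam * max (m - m') 0 - Lam * max (-(m - m')) 0 - gam * |p - p'| - del * |u - u'|
          ≤ F m p u t - F m' p' u' t ∧
        F m p u t - F m' p' u' t
          ≤ Lam * max (m - m') 0 - lam * max (-(m - m')) 0 + gam * |p - p'| + del * |u - u'|)
    (n : ℕ) :
    ∃ μ k : ℝ, 0 < k ∧ ∃ ψ m : ℝ → ℝ, Continuous ψ ∧ Continuous m ∧
      (∀ t, F (m t) (k * Real.cos (ψ t)) (Real.sin (ψ t)) t = -μ * Real.sin (ψ t)) ∧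
      (∀ t ∈ Icc a b, HasDerivWithinAt ψ
        (k * Real.cos (ψ t) ^ 2 - Real.sin (ψ t) * m t / k) (Icc a b) t) ∧
      ψ a = Real.pi ∧ ψ b = Real.pi + (n + 1) * Real.pi := by
  obtain ⟨H, hH, hHc, hHl⟩ := exists_elliptic_inverse hlam hF hF2
  have hpi := Real.pi_pos
  have hba : 0 < b - a := sub_pos.2 hab
  have hLam0 : 0 < Lam := hlam.trans_le hLam
  obtain ⟨k, hk_def⟩ : ∃ k : ℝ, k = gam / lam + (n + 1) * Real.pi / (b - a) := ⟨_, rfl⟩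
  have hk : 0 < k := by rw [hk_def]; positivity
  have hH0 : ∀ t, H 0 0 0 t = 0 := by
    intro t
    have h1 := hF2 (H 0 0 0 t) 0 0 0 0 0 t
    rw [hH, hF0] at h1
    simp only [sub_zero, sub_self, abs_zero, mul_zero, add_zero] at h1
    rcases le_total 0 (H 0 0 0 t) with h | h
    · rw [max_eq_left h, max_eq_right (by linarith)] at h1
      nlinarith
    · rw [max_eq_right h, max_eq_left (by linarith)] at h1
      nlinarith
  set h : ℝ → ℝ → ℝ → ℝ := fun μ t x =>
    H (k * Real.cos x) (Real.sin x) (-μ * Real.sin x) t with hh_def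
  have hh : ∀ μ t x, F (h μ t x) (k * Real.cos x) (Real.sin x) t = -μ * Real.sin x :=
    fun μ t x => hH _ _ _ _
  have hhc : ∀ μ, Continuous fun z : ℝ × ℝ => h μ z.1 z.2 := fun μ =>
    hHc.comp (by fun_prop : Continuous fun z : ℝ × ℝ =>
      (k * Real.cos z.2, Real.sin z.2, -μ * Real.sin z.2, z.1))
  have hhbound : ∀ μ t x, |h μ t x| ≤ (|μ| + gam * k + del) / lam := by
    intro μ t x
    rw [le_div_iff₀ hlam, mul_comm]
    have h1 := hHl (k * Real.cos x) (Real.sin x) (-μ * Real.sin x) 0 0 0 t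
    rw [hH0] at h1
    simp only [sub_zero, abs_mul, abs_neg, abs_of_pos hk] at h1
    have hs := Real.abs_sin_le_one x
    have hc := Real.abs_cos_le_one x
    have e1 : |μ| * |Real.sin x| ≤ |μ| := mul_le_of_le_one_right (abs_nonneg _) hs
    have e2 : gam * (k * |Real.cos x|) ≤ gam * k := by gcongr; exact mul_le_of_le_one_right hk.le hc
    have e3 : del * |Real.sin x| ≤ del := mul_le_of_le_one_right hdel.le hs
    linarith
  have hhlip : ∀ μ t x y, |h μ t x - h μ t y| ≤ (|μ| + gam * k + del) / lam * |x - y| := by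
    intro μ t x y
    rw [div_mul_eq_mul_div, le_div_iff₀ hlam, mul_comm]
    have h1 := hHl (k * Real.cos x) (Real.sin x) (-μ * Real.sin x)
      (k * Real.cos y) (Real.sin y) (-μ * Real.sin y) t
    simp only [← mul_sub, abs_mul, abs_neg, abs_of_pos hk] at h1
    have hs := Real.abs_sin_sub_sin_le x y
    have hc := Real.abs_cos_sub_cos_le x y
    have e1 := mul_le_mul_of_nonneg_left hs (abs_nonneg μ)
    have e2 := mul_le_mul_of_nonneg_left hc (by positivity : 0 ≤ gam * k)
    have e3 := mul_le_mul_of_nonneg_left hs hdel.le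
    linarith
  have hhpar : ∀ μ ν t x, |h μ t x - h ν t x| ≤ |μ - ν| / lam := by
    intro μ ν t x
    rw [le_div_iff₀ hlam, mul_comm]
    have h1 := hHl (k * Real.cos x) (Real.sin x) (-μ * Real.sin x)
      (k * Real.cos x) (Real.sin x) (-ν * Real.sin x) t
    simp only [sub_self, abs_zero, mul_zero, add_zero, ← sub_mul, abs_mul] at h1
    have e1 : |-μ - -ν| * |Real.sin x| ≤ |-μ - -ν| :=
      mul_le_of_le_one_right (abs_nonneg _) (Real.abs_sin_le_one x)
    have e2 : |-μ - -ν| = |μ - ν| := by rw [← abs_neg]; congr 1; ring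
    linarith
  set v : ℝ → ℝ → ℝ → ℝ := fun μ t x =>
    k * Real.cos x ^ 2 - Real.sin x * h μ t x / k with hv_def
  have hsh : ∀ μ t x, |Real.sin x * h μ t x / k| ≤ (|μ| + gam * k + del) / lam / k := by
    intro μ t x
    rw [abs_div, abs_mul, abs_of_pos hk]
    gcongr
    exact (mul_le_of_le_one_left (abs_nonneg _) (Real.abs_sin_le_one x)).trans (hhbound μ t x)
  obtain ⟨ψ, hψa, hψ, hψc⟩ := exists_solution_family hab.le Real.pi (v := v)
    (M := fun μ => k + (|μ| + gam * k + del) / lam / k)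
    (K := fun μ => 2 * k + 2 * ((|μ| + gam * k + del) / lam) / k) (C := 1 / lam / k)
    (fun μ x => by
      have := (hhc μ).comp (by fun_prop : Continuous fun t : ℝ => (t, x))
      simp only [Function.comp_def] at this
      simp only [hv_def]
      fun_prop)
    (fun μ t x => by
      refine (abs_sub _ _).trans (add_le_add ?_ (hsh μ t x))
      rw [abs_of_nonneg (by positivity)]
      exact mul_le_of_le_one_right hk.le (Real.cos_sq_le_one x))
    (fun μ t x y => by
      have e1 : |k * (Real.cos x ^ 2 - Real.cos y ^ 2)| ≤ 2 * k * |x - y| := by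
        rw [sq_sub_sq, abs_mul, abs_mul, abs_of_pos hk]
        have : |Real.cos x + Real.cos y| ≤ 2 := (abs_add_le _ _).trans
          (by linarith [Real.abs_cos_le_one x, Real.abs_cos_le_one y])
        have := mul_le_mul this (Real.abs_cos_sub_cos_le x y) (abs_nonneg _) (by norm_num)
        nlinarith
      have e2 : |Real.sin x * h μ t x - Real.sin y * h μ t y|
          ≤ 2 * ((|μ| + gam * k + del) / lam) * |x - y| := by
        have : Real.sin x * h μ t x - Real.sin y * h μ t y
          = (Real.sin x - Real.sin y) * h μ t x + Real.sin y * (h μ t x - h μ t y) := by ring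
        rw [this]
        refine (abs_add_le _ _).trans ?_
        rw [abs_mul, abs_mul]
        have := mul_le_mul (Real.abs_sin_sub_sin_le x y) (hhbound μ t x) (abs_nonneg _)
          (abs_nonneg _)
        have := mul_le_mul (Real.abs_sin_le_one y) (hhlip μ t x y) (abs_nonneg _) zero_le_one
        linarith
      have e3 : v μ t x - v μ t y = k * (Real.cos x ^ 2 - Real.cos y ^ 2)
          - (Real.sin x * h μ t x - Real.sin y * h μ t y) / k := by
        simp only [hv_def]; ring
      rw [e3]
      refine (abs_sub _ _).trans ?_
      rw [abs_div _ k, abs_of_pos hk, add_mul]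
      refine add_le_add e1 ?_
      rw [div_mul_eq_mul_div]
      gcongr)
    (fun μ ν t x => by
      have e3 : v μ t x - v ν t x = -(Real.sin x * (h μ t x - h ν t x)) / k := by
        simp only [hv_def]; ring
      rw [e3, abs_div, abs_neg, abs_mul, abs_of_pos hk, div_mul_eq_mul_div, div_mul_eq_mul_div,
        one_mul]
      gcongr
      exact (mul_le_of_le_one_left (abs_nonneg _) (Real.abs_sin_le_one x)).trans (hhpar μ ν t x))
  have hright : ∀ ν, ∀ t ∈ Ico a b, HasDerivWithinAt (ψ ν) (v ν t (ψ ν t)) (Ici t) t :=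
    fun ν t ht => (hψ ν t ⟨ht.1, ht.2.le⟩).mono_of_mem_nhdsWithin
      (Filter.mem_of_superset (Icc_mem_nhdsGE ht.2) (Icc_subset_Icc_left ht.1))
  have hψcont : ∀ ν, ContinuousOn (ψ ν) (Icc a b) :=
    fun ν t ht => (hψ ν t ht).continuousWithinAt
  have hlow : ψ (-del - 1) b ≤ Real.pi + (n + 1) * Real.pi := by
    have hB : ψ (-del - 1) b ≤ Real.pi / 2 + Real.pi := by
      refine image_le_of_deriv_right_lt_deriv_boundary (hψcont _) (hright _)
        (B := fun _ => Real.pi / 2 + Real.pi) (B' := fun _ => 0) (by rw [hψa]; linarith)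
        (fun x => hasDerivAt_const x _) (fun t _ he => ?_) (right_mem_Icc.2 hab.le)
      simp only [hv_def, he, Real.cos_add_pi, Real.sin_add_pi, Real.cos_pi_div_two,
        Real.sin_pi_div_two]
      have h1 := hh (-del - 1) t (Real.pi / 2 + Real.pi)
      rw [Real.cos_add_pi, Real.sin_add_pi, Real.cos_pi_div_two, Real.sin_pi_div_two] at h1
      set m := h (-del - 1) t (Real.pi / 2 + Real.pi)
      have h2 := (hF2 m (k * -0) (-1) 0 0 0 t).1
      rw [h1, hF0] at h2
      have hm : m < 0 := by
        by_contra! hm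
        simp only [sub_zero, max_eq_left hm, max_eq_right (by linarith : -m ≤ 0)] at h2
        simp only [neg_zero, mul_zero, abs_zero, abs_neg, abs_one] at h2
        nlinarith
      have := div_neg_of_neg_of_pos hm hk
      have e : k * (-0) ^ 2 - -1 * m / k = m / k := by ring
      rw [e]; exact this
    have : (0 : ℝ) ≤ n * Real.pi := by positivity
    linarith
  have hhigh : Real.pi + (n + 1) * Real.pi ≤ ψ (del + Lam * k ^ 2) b := by
    have hspeed : ∀ t x, (n + 1) * Real.pi / (b - a) ≤ v (del + Lam * k ^ 2) t x := by
      intro t x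
      have h2 := hF2 (h (del + Lam * k ^ 2) t x) (k * Real.cos x) (Real.sin x) 0 0 0 t
      rw [hh, hF0] at h2
      simp only [sub_zero, abs_mul, abs_of_pos hk] at h2
      have e1 : (n + 1) * Real.pi / (b - a) = k - gam / lam := by rw [hk_def]; ring
      rw [e1]
      exact pruefer_speed_ge hlam hLam hgam hk (Real.sin_sq_add_cos_sq x) h2.1 h2.2
    have hB := image_le_of_deriv_right_le_deriv_boundary
      (f := fun t => Real.pi + (n + 1) * Real.pi / (b - a) * (t - a))
      (f' := fun _ => (n + 1) * Real.pi / (b - a)) (B := ψ (del + Lam * k ^ 2))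
      (by fun_prop)
      (fun t _ => by
        simpa using ((((hasDerivAt_id t).sub_const a).const_mul
          ((n + 1) * Real.pi / (b - a))).const_add Real.pi).hasDerivWithinAt)
      (by simp [hψa]) (hψcont _) (hright _) (fun t _ => hspeed t _) (right_mem_Icc.2 hab.le)
    simpa [div_mul_cancel₀ _ hba.ne'] using hB
  obtain ⟨μ, -, hμ⟩ := intermediate_value_Icc (f := fun μ => ψ μ b)
    (by have : 0 ≤ Lam * k ^ 2 := by positivity
        linarith : -del - 1 ≤ del + Lam * k ^ 2) hψc.continuousOn ⟨hlow, hhigh⟩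
  have hext : ∀ t ∈ Icc a b, IccExtend hab.le ((Icc a b).domRestrict (ψ μ)) t = ψ μ t :=
    fun t ht => IccExtend_of_mem hab.le _ ht
  have hext_cont : Continuous (IccExtend hab.le ((Icc a b).domRestrict (ψ μ))) :=
    (continuousOn_iff_continuous_domRestrict.1 (hψcont μ)).Icc_extend'
  refine ⟨μ, k, hk, IccExtend hab.le ((Icc a b).domRestrict (ψ μ)),
    fun t => h μ t (IccExtend hab.le ((Icc a b).domRestrict (ψ μ)) t), hext_cont,
    (hhc μ).comp (continuous_id.prodMk hext_cont), fun t => hh _ _ _, fun t ht => ?_, ?_, ?_⟩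
  · simp only [hext t ht]
    exact (hψ μ t ht).congr hext (hext t ht)
  · rw [hext a (left_mem_Icc.2 hab.le), hψa]
  · rw [hext b (right_mem_Icc.2 hab.le), ← hμ]

/-- A scaled Prüfer angle comes from a solution `u = ρ sin ψ` with positive amplitude `ρ`. -/
theorem exists_solution_of_pruefer_angle {a b k μ : ℝ} (hk : 0 < k) {F : ℝ → ℝ → ℝ → ℝ → ℝ}
    (hF1 : ∀ s : ℝ, 0 ≤ s → ∀ m p u : ℝ, ∀ t ∈ Icc a b,
      F (s * m) (s * p) (s * u) t = s * F m p u t)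
    {ψ m : ℝ → ℝ} (hψc : Continuous ψ) (hm : Continuous m)
    (hFm : ∀ t ∈ Icc a b,
      F (m t) (k * Real.cos (ψ t)) (Real.sin (ψ t)) t = -μ * Real.sin (ψ t))
    (hψ : ∀ t ∈ Icc a b, HasDerivWithinAt ψ
        (k * Real.cos (ψ t) ^ 2 - Real.sin (ψ t) * m t / k) (Icc a b) t) :
    ∃ ρ u' u'' : ℝ → ℝ, (∀ t, 0 < ρ t) ∧
      C2Fun a b (fun t => ρ t * Real.sin (ψ t)) u' u'' ∧
      ∀ t ∈ Icc a b, F (u'' t) (u' t) (ρ t * Real.sin (ψ t)) t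
        = -μ * (ρ t * Real.sin (ψ t)) := by
  set q : ℝ → ℝ := fun t =>
    k * Real.cos (ψ t) * Real.sin (ψ t) + Real.cos (ψ t) * m t / k with hq_def
  have hq : Continuous q := by fun_prop
  set ρ : ℝ → ℝ := fun t => Real.exp (∫ x in a..t, q x)
  have hρ : ∀ t, HasDerivAt ρ (ρ t * q t) t := fun t =>
    (hq.integral_hasStrictDerivAt a t).hasDerivAt.exp
  have hρc : Continuous ρ := continuous_iff_continuousAt.2 fun t => (hρ t).continuousAt
  have hpyth : ∀ t, Real.sin (ψ t) ^ 2 + Real.cos (ψ t) ^ 2 = 1 :=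
    fun t => Real.sin_sq_add_cos_sq _
  refine ⟨ρ, fun t => ρ t * (k * Real.cos (ψ t)), fun t => ρ t * m t, fun t => Real.exp_pos _,
    ⟨fun t ht => ?_, by fun_prop, fun t ht => ?_, by fun_prop⟩, fun t ht => ?_⟩
  · refine ((hρ t).hasDerivWithinAt.mul (hψ t ht).sin).congr_deriv ?_
    simp only [hq_def]
    field_simp
    linear_combination ρ t * k ^ 2 * Real.cos (ψ t) * hpyth t
  · have hd := (hψ t (Ioo_subset_Icc_self ht)).hasDerivAt (Icc_mem_nhds ht.1 ht.2)
    refine ((hρ t).mul (hd.cos.const_mul k)).congr_deriv ?_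
    simp only [hq_def]
    field_simp
    linear_combination ρ t * m t * hpyth t
  · rw [hF1 _ (Real.exp_pos _).le _ _ _ t ht, hFm t ht]
    ring

theorem C2Fun.mono {a b c d : ℝ} {u u' u'' : ℝ → ℝ} (h : C2Fun a b u u' u'') (hc : a ≤ c)
    (hd : d ≤ b) : C2Fun c d u u' u'' := by
  have hIcc : Icc c d ⊆ Icc a b := Icc_subset_Icc hc hd
  have hIoo : Ioo c d ⊆ Ioo a b := Ioo_subset_Ioo hc hd
  exact ⟨fun t ht => (h.1 t (hIcc ht)).mono hIcc, h.2.1.mono hIcc,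
    fun t ht => h.2.2.1 t (hIoo ht), h.2.2.2.mono hIoo⟩

theorem sin_pos_of_even {j : ℕ} (hj : Even j) {x : ℝ} (h1 : j * Real.pi < x)
    (h2 : x < j * Real.pi + Real.pi) : 0 < Real.sin x := by
  have := Real.sin_pos_of_pos_of_lt_pi (x := x - j * Real.pi) (by linarith) (by linarith)
  rwa [Real.sin_sub_nat_mul_pi, hj.neg_one_pow, one_mul] at this

theorem sin_neg_of_odd {j : ℕ} (hj : Odd j) {x : ℝ} (h1 : j * Real.pi < x)
    (h2 : x < j * Real.pi + Real.pi) : Real.sin x < 0 := by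
  have := Real.sin_pos_of_pos_of_lt_pi (x := x - j * Real.pi) (by linarith) (by linarith)
  rw [Real.sin_sub_nat_mul_pi, hj.neg_one_pow] at this
  linarith

/-- Nehari-type matching; for every `n ≥ 1` there is a partition
`a = t₀ < t₁ < ... < tₙ < t_{n+1} = b` such that
`λ^{(-1)^i}(t_{i-1},t_i) = λ^{(-1)^{i+1}}(t_i,t_{i+1})` for `i = 1,...,n`. -/
theorem stmt_9
    (a b lam Lam gam del : ℝ) (hab : a < b)
    (hlam : 0 < lam) (hLam : lam ≤ Lam) (hgam : 0 < gam) (hdel : 0 < del)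
    (F : ℝ → ℝ → ℝ → ℝ → ℝ)
    (hFcont : ContinuousOn (fun z : ℝ × ℝ × ℝ × ℝ => F z.1 z.2.1 z.2.2.1 z.2.2.2)
      {z : ℝ × ℝ × ℝ × ℝ | z.2.2.2 ∈ Icc a b})
    (hF1 : ∀ s : ℝ, 0 ≤ s → ∀ m p u : ℝ, ∀ t ∈ Icc a b,
      F (s * m) (s * p) (s * u) t = s * F m p u t)
    (hF2 : ∀ m p u m' p' u' : ℝ, ∀ t ∈ Icc a b,
      lam * max (m - m') 0 - Lam * max (-(m - m')) 0 - gam * |p - p'| - del * |u - u'|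
          ≤ F m p u t - F m' p' u' t ∧
        F m p u t - F m' p' u' t
          ≤ Lam * max (m - m') 0 - lam * max (-(m - m')) 0 + gam * |p - p'| + del * |u - u'|)
    (hF3 : ∀ m p u m' p' u' : ℝ, ∀ t ∈ Icc a b,
      -F (m' - m) (p' - p) (u' - u) t ≤ F m p u t - F m' p' u' t ∧
        F m p u t - F m' p' u' t ≤ F (m - m') (p - p') (u - u') t)
    (n : ℕ) (hn : 1 ≤ n) :
    ∃ t : ℕ → ℝ, t 0 = a ∧ t (n + 1) = b ∧
      (∀ i : ℕ, i ≤ n → t i < t (i + 1)) ∧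
      (∀ i : ℕ, 1 ≤ i → i ≤ n → ∃ μ : ℝ,
        (Even i →
          IsPosEigenvalue F (t (i - 1)) (t i) μ ∧ IsNegEigenvalue F (t i) (t (i + 1)) μ) ∧
        (¬ Even i →
          IsNegEigenvalue F (t (i - 1)) (t i) μ ∧ IsPosEigenvalue F (t i) (t (i + 1)) μ)) := by
  have hpi := Real.pi_pos
  set G : ℝ → ℝ → ℝ → ℝ → ℝ := fun m p u t => F m p u (projIcc a b hab.le t) with hG_def
  have hproj : ∀ t ∈ Icc a b, (projIcc a b hab.le t : ℝ) = t := fun t ht => by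
    rw [projIcc_of_mem hab.le ht]
  have hGc : Continuous fun z : ℝ × ℝ × ℝ × ℝ => G z.1 z.2.1 z.2.2.1 z.2.2.2 := by
    have hφ : Continuous fun z : ℝ × ℝ × ℝ × ℝ =>
        (z.1, z.2.1, z.2.2.1, (projIcc a b hab.le z.2.2.2 : ℝ)) := by
      have : Continuous fun z : ℝ × ℝ × ℝ × ℝ => (projIcc a b hab.le z.2.2.2 : ℝ) :=
        continuous_subtype_val.comp (continuous_projIcc.comp (by fun_prop))
      fun_prop
    exact hFcont.comp_continuous hφ fun z => (projIcc a b hab.le z.2.2.2).2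
  have hG0 : ∀ t, G 0 0 0 t = 0 := fun t => by
    simpa using hF1 0 le_rfl 0 0 0 _ (projIcc a b hab.le t).2
  obtain ⟨μ, k, hk, ψ, m, hψc, hmc, hFm, hψ, hψa, hψb⟩ :=
    exists_pruefer_angle hab hlam hLam hgam hdel hGc hG0
      (fun m p u m' p' u' t => hF2 m p u m' p' u' _ (projIcc a b hab.le t).2) n
  obtain ⟨ρ, u', u'', hρ, hC2, hsol⟩ := exists_solution_of_pruefer_angle hk hF1 hψc hmc
    (fun t ht => by simpa only [hG_def, hproj t ht] using hFm t) hψ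
  have hcross : ∀ j : ℕ, ∀ s ∈ Icc a b, ∀ t ∈ Icc a b, s < t → j * Real.pi ≤ ψ s →
      j * Real.pi < ψ t := fun j s hs t ht hst hj => by
    refine lt_of_deriv_pos_at_level hψ (fun x _ hx => ?_) hs ht hst hj
    have hsin : Real.sin (ψ x) = 0 := by rw [hx, Real.sin_nat_mul_pi]
    have hcos : Real.cos (ψ x) ^ 2 = 1 := by
      have := Real.sin_sq_add_cos_sq (ψ x)
      rwa [hsin, zero_pow two_ne_zero, zero_add] at this
    rw [hsin, hcos]
    simpa using hk
  have hlevel : ∀ i : ℕ, ∃ t, i ≤ n + 1 → t ∈ Icc a b ∧ ψ t = (i + 1 : ℕ) * Real.pi := by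
    intro i
    by_cases hi : i ≤ n + 1
    · have hi' : (i : ℝ) ≤ n + 1 := by exact_mod_cast hi
      obtain ⟨t, ht, h⟩ := intermediate_value_Icc hab.le hψc.continuousOn
        (show ((i + 1 : ℕ) : ℝ) * Real.pi ∈ Icc (ψ a) (ψ b) by
          rw [hψa, hψb]
          push_cast
          constructor <;> nlinarith [Nat.cast_nonneg (α := ℝ) i])
      exact ⟨t, fun _ => ⟨ht, h⟩⟩
    · exact ⟨0, fun h => absurd h hi⟩
  choose t ht using hlevel
  have hinj : ∀ j : ℕ, ∀ x ∈ Icc a b, ∀ y ∈ Icc a b, ψ x = j * Real.pi → ψ y = j * Real.pi →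
      x = y := by
    intro j x hx y hy h1 h2
    rcases lt_trichotomy x y with h | h | h
    · exact absurd h2 (hcross j x hx y hy h h1.ge).ne'
    · exact h
    · exact absurd h1 (hcross j y hy x hx h h2.ge).ne'
  have hmono : ∀ i ≤ n, t i < t (i + 1) := by
    intro i hi
    obtain ⟨h1, h2⟩ := ht i (by omega)
    obtain ⟨h3, h4⟩ := ht (i + 1) (by omega)
    by_contra! hle
    have : ((i + 1 + 1 : ℕ) : ℝ) * Real.pi ≤ ψ (t i) := by
      rcases hle.eq_or_lt with h | h
      · rw [← h, h4]
      · exact (hcross _ _ h3 _ h1 h h4.ge).le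
    rw [h2] at this
    push_cast at this
    linarith
  have hbetween : ∀ i ≤ n, ∀ x ∈ Ioo (t i) (t (i + 1)),
      (i + 1 : ℕ) * Real.pi < ψ x ∧ ψ x < (i + 1 : ℕ) * Real.pi + Real.pi := by
    intro i hi x hx
    obtain ⟨h1, h2⟩ := ht i (by omega)
    obtain ⟨h3, h4⟩ := ht (i + 1) (by omega)
    have hxab : x ∈ Icc a b := ⟨h1.1.trans hx.1.le, hx.2.le.trans h3.2⟩
    refine ⟨hcross _ _ h1 _ hxab hx.1 h2.ge, ?_⟩
    by_contra! hle
    refine (hcross (i + 1 + 1) _ hxab _ h3 hx.2 ?_).ne' h4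
    push_cast at hle ⊢
    linarith
  have hzero : ∀ i ≤ n + 1, ρ (t i) * Real.sin (ψ (t i)) = 0 := fun i hi => by
    rw [(ht i hi).2, Real.sin_nat_mul_pi, mul_zero]
  have hsub : ∀ i ≤ n, Ioo (t i) (t (i + 1)) ⊆ Icc a b := fun i hi x hx =>
    ⟨(ht i (by omega)).1.1.trans hx.1.le, hx.2.le.trans (ht (i + 1) (by omega)).1.2⟩
  have hP : ∀ i ≤ n, ¬ Even i → IsPosEigenvalue F (t i) (t (i + 1)) μ := fun i hi hodd =>
    ⟨_, u', u'', hC2.mono (ht i (by omega)).1.1 (ht (i + 1) (by omega)).1.2,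
      fun x hx => hsol x (hsub i hi hx), hzero i (by omega), hzero (i + 1) (by omega),
      fun x hx => mul_pos (hρ x) (sin_pos_of_even (Nat.even_add_one.2 hodd)
        (hbetween i hi x hx).1 (hbetween i hi x hx).2)⟩
  have hN : ∀ i ≤ n, Even i → IsNegEigenvalue F (t i) (t (i + 1)) μ := fun i hi heven =>
    ⟨_, u', u'', hC2.mono (ht i (by omega)).1.1 (ht (i + 1) (by omega)).1.2,
      fun x hx => hsol x (hsub i hi hx), hzero i (by omega), hzero (i + 1) (by omega),
      fun x hx => mul_neg_of_pos_of_neg (hρ x) (sin_neg_of_odd heven.add_one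
        (hbetween i hi x hx).1 (hbetween i hi x hx).2)⟩
  refine ⟨t, ?_, ?_, hmono, fun i hi1 hin => ⟨μ, fun heven => ⟨?_, hN i hin heven⟩,
    fun hodd => ⟨?_, hP i hin hodd⟩⟩⟩
  · exact hinj 1 _ (ht 0 (by omega)).1 _ (left_mem_Icc.2 hab.le)
      (by simpa using (ht 0 (by omega)).2) (by simpa using hψa)
  · refine hinj (n + 1 + 1) _ (ht (n + 1) le_rfl).1 _ (right_mem_Icc.2 hab.le)
      (ht (n + 1) le_rfl).2 ?_
    rw [hψb]
    push_cast
    ring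
  · obtain ⟨j, rfl⟩ := Nat.exists_eq_add_of_le' hi1
    exact hP j (by omega) (Nat.even_add_one.1 heven)
  · obtain ⟨j, rfl⟩ := Nat.exists_eq_add_of_le' hi1
    exact hN j (by omega) (by rwa [Nat.even_add_one, not_not] at hodd)
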